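/- There exists a prime number d with d ≡ 3 (mod 4) such that every fundamental solution a of the Pell equation x² − d·y² = 1 satisfies d ∣ a.y. In other words, Mordell's Pellian Equation Conjecture is false. -/

import Mathlib

/-!
The counterexample is `d = 39028039587479`.  A huge solution of the Pell equation is produced by a
chain of duplications (Gauss composition) of binary quadratic forms of discriminant `4 d`
representing `1`, keeping track only of residues and of the size of the representation.
-/

/-- The form `a k² + 2 b k l + c l²` represents `1` at some `(k, l)` which is congruent
to `(u, v)` modulo `N` and has entries of absolute value at most `2 ^ e`. -/
def FormRep (N a b c u v : ℤ) (e : ℕ) : Prop :=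
  ∃ k l : ℤ, a * k ^ 2 + 2 * b * k * l + c * l ^ 2 = 1 ∧ k ≡ u [ZMOD N] ∧ l ≡ v [ZMOD N] ∧
    |k| ≤ 2 ^ e ∧ |l| ≤ 2 ^ e

lemma quad_bound {k l B p q r T : ℤ} (hk : |k| ≤ B) (hl : |l| ≤ B) (hT : |p| + |q| + |r| ≤ T) :
    |p * k ^ 2 + q * k * l + r * l ^ 2| ≤ B * B * T := by
  have hB : 0 ≤ B := (abs_nonneg k).trans hk
  have h1 : |k| * |k| ≤ B * B := mul_le_mul hk hk (abs_nonneg _) hB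
  have h2 : |k| * |l| ≤ B * B := mul_le_mul hk hl (abs_nonneg _) hB
  have h3 : |l| * |l| ≤ B * B := mul_le_mul hl hl (abs_nonneg _) hB
  calc |p * k ^ 2 + q * k * l + r * l ^ 2|
      ≤ |p * k ^ 2| + |q * k * l| + |r * l ^ 2| := abs_add_three _ _ _
    _ = |p| * (|k| * |k|) + |q| * (|k| * |l|) + |r| * (|l| * |l|) := by
        simp only [abs_mul, abs_pow]; ring
    _ ≤ |p| * (B * B) + |q| * (B * B) + |r| * (B * B) := by gcongr
    _ = B * B * (|p| + |q| + |r|) := by ring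
    _ ≤ B * B * T := by gcongr

lemma FormRep.step {N a b c u v : ℤ} {e : ℕ} (h : FormRep N a b c u v e)
    (p q r p' q' r' A B C u' v' : ℤ) (t e' : ℕ)
    (hid : ∀ k l : ℤ, A * (p * k ^ 2 + q * k * l + r * l ^ 2) ^ 2
      + 2 * B * (p * k ^ 2 + q * k * l + r * l ^ 2) * (p' * k ^ 2 + q' * k * l + r' * l ^ 2)
      + C * (p' * k ^ 2 + q' * k * l + r' * l ^ 2) ^ 2
      = (a * k ^ 2 + 2 * b * k * l + c * l ^ 2) ^ 2)
    (hu : p * u ^ 2 + q * u * v + r * v ^ 2 ≡ u' [ZMOD N])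
    (hv : p' * u ^ 2 + q' * u * v + r' * v ^ 2 ≡ v' [ZMOD N])
    (ht : |p| + |q| + |r| ≤ 2 ^ t) (ht' : |p'| + |q'| + |r'| ≤ 2 ^ t)
    (he : e + e + t = e') : FormRep N A B C u' v' e' := by
  obtain ⟨k, l, h1, hk, hl, bk, bl⟩ := h
  subst he
  refine ⟨p * k ^ 2 + q * k * l + r * l ^ 2, p' * k ^ 2 + q' * k * l + r' * l ^ 2,
    ?_, ?_, ?_, ?_, ?_⟩
  · rw [hid, h1, one_pow]
  · refine Int.ModEq.trans ?_ hu
    gcongr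
  · refine Int.ModEq.trans ?_ hv
    gcongr
  · rw [pow_add, pow_add]; exact quad_bound bk bl ht
  · rw [pow_add, pow_add]; exact quad_bound bk bl ht'

lemma rep0 : FormRep 39028156671597762437 411101 5838542 (-12015215)
    (-33960972) 1155191 26 :=
  ⟨-33960972, 1155191, by norm_num, rfl, rfl, by norm_num, by norm_num⟩

lemma rep1 : FormRep 39028156671597762437 1637617 5602634 (-4664419)
    39026556006242193627 221207097356779 76 :=
  rep0.step (-3890) (-228642) (-3360914)
    (-9879) (-580868) (-8538341) _ _ _ _ _ 24 _
    (fun k l => by ring) (by decide) (by decide) (by norm_num) (by norm_num) (by norm_num)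

lemma rep2 : FormRep 39028156671597762437 142049 6178576 (-6006647)
    12534332846461527471 25051440680186531244 180 :=
  rep1.step (-1455519) (-21064412) (-76211557)
    (-3011000) (-43575486) (-157657172) _ _ _ _ _ 28 _
    (fun k l => by ring) (by decide) (by decide) (by norm_num) (by norm_num) (by norm_num)

lemma rep3 : FormRep 39028156671597762437 5454305 2414523 (-6086590)
    32612404899803839156 13301573857819798076 385 :=
  rep2.step 2129 372406 16288231
    3029 529968 23179619 _ _ _ _ _ 25 _
    (fun k l => by ring) (by decide) (by decide) (by norm_num) (by norm_num) (by norm_num)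

lemma rep4 : FormRep 39028156671597762437 3076357 6074415 (-692222)
    3237361599391218031 30910153347493078753 797 :=
  rep3.step 959567 3047700 2419966
    17080437 54249530 43075764 _ _ _ _ _ 27 _
    (fun k l => by ring) (by decide) (by decide) (by norm_num) (by norm_num) (by norm_num)

lemma rep5 : FormRep 39028156671597762437 3447173 4483875 (-5489398)
    20859753802731139865 21002645962858220231 1622 :=
  rep4.step (-3024967) (-24231652) (-48527222)
    (-5913449) (-47369986) (-94864924) _ _ _ _ _ 28 _
    (fun k l => by ring) (by decide) (by decide) (by norm_num) (by norm_num) (by norm_num)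

lemma rep6 : FormRep 39028156671597762437 4724869 4906284 (-3165467)
    20850795594130156827 1521080883668747213 3276 :=
  rep5.step (-47468969) (-295543674) (-460016644)
    (-167256966) (-1041348470) (-1620869166) _ _ _ _ _ 32 _
    (fun k l => by ring) (by decide) (by decide) (by norm_num) (by norm_num) (by norm_num)

lemma rep7 : FormRep 39028156671597762437 3968057 3707690 (-6371147)
    7347227775409434357 12817665284813345766 6570 :=
  rep6.step (-10542) (-49310) (-58266)
    (-16301) (-77144) (-91027) _ _ _ _ _ 18 _
    (fun k l => by ring) (by decide) (by decide) (by norm_num) (by norm_num) (by norm_num)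

lemma rep8 : FormRep 39028156671597762437 652865 6062112 (-3490519)
    8714871648927032727 31943077268382349820 13176 :=
  rep7.step 1255519345 6299612332 7902131435
    4427603108 22215653826 27866955488 _ _ _ _ _ 36 _
    (fun k l => by ring) (by decide) (by decide) (by norm_num) (by norm_num) (by norm_num)

lemma rep9 : FormRep 39028156671597762437 2833889 4866445 (-5415086)
    1217491569637257218 22287174474712661834 26383 :=
  rep8.step 2615773 98637474 929873435
    5368499 202439272 1908431893 _ _ _ _ _ 31 _
    (fun k l => by ring) (by decide) (by decide) (by norm_num) (by norm_num) (by norm_num)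

lemma rep10 : FormRep 39028156671597762437 9942193 4389541 (-1987486)
    15287123255957087387 23908531600847735367 52797 :=
  rep9.step 9489475 74429916 145946230
    50786517 398339866 781086488 _ _ _ _ _ 31 _
    (fun k l => by ring) (by decide) (by decide) (by norm_num) (by norm_num) (by norm_num)

lemma rep11 : FormRep 39028156671597762437 79073 6169645 (-12185198)
    26997579987598723331 14875836465792496912 105619 :=
  rep10.step (-5302167) (-11345180) (-6068894)
    (-5402981) (-11560898) (-6184288) _ _ _ _ _ 25 _
    (fun k l => by ring) (by decide) (by decide) (by norm_num) (by norm_num) (by norm_num)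

lemma rep12 : FormRep 39028156671597762437 448009 6210041 (-1034422)
    36491701732550856769 19060243136300814916 211263 :=
  rep11.step 79 24644 1935014
    945 296794 23302880 _ _ _ _ _ 25 _
    (fun k l => by ring) (by decide) (by decide) (by norm_num) (by norm_num) (by norm_num)

lemma rep13 : FormRep 39028156671597762437 6211321 4968267 (-2309390)
    17867528120111962580 28755695697417960155 422556 :=
  rep12.step 204189 11355308 157872154
    991640 55146842 766703178 _ _ _ _ _ 30 _
    (fun k l => by ring) (by decide) (by decide) (by norm_num) (by norm_num) (by norm_num)

lemma rep14 : FormRep 39028156671597762437 6733621 2257251 (-5039318)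
    20333826043402886538 19767810320495573132 845149 :=
  rep13.step (-8820135299) (-31852261944) (-28757115298)
    (-14885106246) (-53754765334) (-48531309558) _ _ _ _ _ 37 _
    (fun k l => by ring) (by decide) (by decide) (by norm_num) (by norm_num) (by norm_num)

lemma rep15 : FormRep 39028156671597762437 4761329 2935431 (-6387142)
    27988934520862117370 9623650009358928988 1690328 :=
  rep14.step (-89253847) (-225453368) (-142372634)
    (-128318572) (-324130054) (-204686450) _ _ _ _ _ 30 _
    (fun k l => by ring) (by decide) (by decide) (by norm_num) (by norm_num) (by norm_num)

lemma rep16 : FormRep 39028156671597762437 330485 6203013 (-1666246)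
    20887228612078034029 16608201747298513977 3380678 :=
  rep15.step 60605 233744 225406
    452813 1746586 1684228 _ _ _ _ _ 22 _
    (fun k l => by ring) (by decide) (by decide) (by norm_num) (by norm_num) (by norm_num)

lemma rep17 : FormRep 39028156671597762437 2756785 4779897 (-5869382)
    19230762396314190049 32922383718829766515 6761389 :=
  rep16.step 1682853 126795164 2388356802
    3161671 238217238 4487140856 _ _ _ _ _ 33 _
    (fun k l => by ring) (by decide) (by decide) (by norm_num) (by norm_num) (by norm_num)

lemma rep18 : FormRep 39028156671597762437 1 0 (-39028039587479)
    29698894088606782278 4631106205489845619 13522828 :=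
  rep17.step 39028042344264 312224326259626 624448627530282
    6247243 49977942 99955880 _ _ _ _ _ 50 _
    (fun k l => by ring) (by decide) (by decide) (by norm_num) (by norm_num) (by norm_num)


lemma zmod_ne_one {p c : ℕ} (hp : c % p ≠ 1 % p) : (c : ZMod p) ≠ 1 := by
  intro h
  exact hp ((ZMod.natCast_eq_natCast_iff' _ _ _).1 (by rw [h, Nat.cast_one]))

lemma prime_d : Nat.Prime 39028039587479 := by
  refine lucas_primality _ (13 : ZMod 39028039587479) ?_ ?_
  · norm_num only
    reduce_mod_char
  · intro q hq hdvd
    have hfac : 39028039587479 - 1 = 2 * 421 * 3187 * 3617 * 4021 := by norm_num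
    rw [hfac] at hdvd
    have hcases : q = 2 ∨ q = 421 ∨ q = 3187 ∨ q = 3617 ∨ q = 4021 := by
      rcases hq.dvd_mul.1 hdvd with h | h
      · rcases hq.dvd_mul.1 h with h | h
        · rcases hq.dvd_mul.1 h with h | h
          · rcases hq.dvd_mul.1 h with h | h
            · exact Or.inl ((Nat.prime_dvd_prime_iff_eq hq (by norm_num)).1 h)
            · exact Or.inr (Or.inl ((Nat.prime_dvd_prime_iff_eq hq (by norm_num)).1 h))
          · exact Or.inr (Or.inr (Or.inl ((Nat.prime_dvd_prime_iff_eq hq (by norm_num)).1 h)))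
        · exact Or.inr (Or.inr (Or.inr (Or.inl
            ((Nat.prime_dvd_prime_iff_eq hq (by norm_num)).1 h))))
      · exact Or.inr (Or.inr (Or.inr (Or.inr
          ((Nat.prime_dvd_prime_iff_eq hq (by norm_num)).1 h))))
    rcases hcases with rfl | rfl | rfl | rfl | rfl
    · have h : (13 : ZMod 39028039587479) ^ 19514019793739 = ((39028039587478 : ℕ) : ZMod 39028039587479) := by
        push_cast
        reduce_mod_char
      norm_num only
      rw [h]
      exact zmod_ne_one (by norm_num)
    · have h : (13 : ZMod 39028039587479) ^ 92703181918 = ((21998654716238 : ℕ) : ZMod 39028039587479) := by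
        push_cast
        reduce_mod_char
      norm_num only
      rw [h]
      exact zmod_ne_one (by norm_num)
    · have h : (13 : ZMod 39028039587479) ^ 12246011794 = ((27265201336215 : ℕ) : ZMod 39028039587479) := by
        push_cast
        reduce_mod_char
      norm_num only
      rw [h]
      exact zmod_ne_one (by norm_num)
    · have h : (13 : ZMod 39028039587479) ^ 10790168534 = ((23144162197652 : ℕ) : ZMod 39028039587479) := by
        push_cast
        reduce_mod_char
      norm_num only
      rw [h]
      exact zmod_ne_one (by norm_num)
    · have h : (13 : ZMod 39028039587479) ^ 9706053118 = ((23854836134359 : ℕ) : ZMod 39028039587479) := by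
        push_cast
        reduce_mod_char
      norm_num only
      rw [h]
      exact zmod_ne_one (by norm_num)

lemma two_pow_le_x {d : ℤ} {a : Pell.Solution₁ d} (h : Pell.IsFundamental a) (n : ℕ) :
    2 ^ n ≤ (a ^ n).x ∧ 0 ≤ (a ^ n).y := by
  have hx : 2 ≤ a.x := h.1
  have hy : 0 < a.y := h.2.1
  have hd : 0 < d := h.d_pos
  induction n with
  | zero => simp
  | succ n ih =>
    obtain ⟨h1, h2⟩ := ih
    have h3 : (0 : ℤ) < 2 ^ n := by positivity
    rw [pow_succ, pow_succ, Pell.Solution₁.x_mul, Pell.Solution₁.y_mul]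
    constructor
    · have h4 : 0 ≤ d * ((a ^ n).y * a.y) := by positivity
      nlinarith
    · have h5 : 0 ≤ (a ^ n).x := by linarith
      positivity

lemma y_pow_modEq {d : ℤ} (a : Pell.Solution₁ d) (n : ℕ) :
    a.x * (a ^ n).y ≡ n * (a.x ^ n * a.y) [ZMOD d] ∧ (a ^ n).x ≡ a.x ^ n [ZMOD d] := by
  induction n with
  | zero => simp
  | succ n ih =>
    obtain ⟨h1, h2⟩ := ih
    have hd : d ≡ 0 [ZMOD d] := by simp [Int.ModEq]
    rw [pow_succ, Pell.Solution₁.x_mul, Pell.Solution₁.y_mul]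
    constructor
    · calc a.x * ((a ^ n).x * a.y + (a ^ n).y * a.x)
          = a.x * (a ^ n).x * a.y + a.x * (a ^ n).y * a.x := by ring
        _ ≡ a.x * a.x ^ n * a.y + n * (a.x ^ n * a.y) * a.x [ZMOD d] := by gcongr
        _ = _ := by push_cast; ring
    · calc (a ^ n).x * a.x + d * ((a ^ n).y * a.y)
          ≡ a.x ^ n * a.x + 0 * ((a ^ n).y * a.y) [ZMOD d] := by gcongr
        _ = _ := by ring

/-- A nontrivial, not too large solution with `d ∣ y` forces `d ∣ y` for the fundamental one. -/
lemma dvd_of_rep {d : ℕ} (hp : d.Prime) {N u v : ℤ} {e : ℕ} (h : FormRep N 1 0 (-d) u v e)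
    (hN : (d : ℤ) ∣ N) (hv : (d : ℤ) ∣ v) (hv0 : ¬ N ∣ v) (he : e < d)
    (a : Pell.Solution₁ (d : ℤ)) (ha : Pell.IsFundamental a) : (d : ℤ) ∣ a.y := by
  obtain ⟨k, l, h1, -, hl, bk, -⟩ := h
  have hpell : k ^ 2 - d * l ^ 2 = 1 := by linarith
  have hdl : (d : ℤ) ∣ l := by
    have := (hl.of_dvd hN).dvd
    exact (dvd_sub_right hv).1 this
  have hl0 : l ≠ 0 := by
    rintro rfl
    exact hv0 (by simpa using hl.dvd)
  -- reduce to a natural power of `a`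
  obtain ⟨n, hx, hy⟩ : ∃ n : ℕ, |k| = (a ^ n).x ∧ |l| = |(a ^ n).y| := by
    obtain ⟨m, hm⟩ := ha.eq_zpow_or_neg_zpow (Pell.Solution₁.mk k l hpell)
    have hxy : |k| = |(a ^ m).x| ∧ |l| = |(a ^ m).y| := by
      rcases hm with hm | hm
      · rw [← hm]; simp
      · have : a ^ m = - Pell.Solution₁.mk k l hpell := by rw [hm, neg_neg]
        rw [this]; simp
    have hpos := Pell.Solution₁.x_zpow_pos ha.x_pos m
    rw [abs_of_pos hpos] at hxy
    obtain ⟨n, rfl | rfl⟩ := m.eq_nat_or_neg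
    · exact ⟨n, by simpa using hxy⟩
    · exact ⟨n, by simpa using hxy⟩
  have hn0 : n ≠ 0 := by
    rintro rfl
    simp at hy
    exact hl0 hy
  have hnd : n < d := by
    have h3 := (two_pow_le_x ha n).1
    have h4 : (2 : ℤ) ^ n ≤ 2 ^ e := by linarith
    have h5 : n ≤ e := (pow_le_pow_iff_right₀ (by norm_num)).1 h4
    omega
  have hdy : (d : ℤ) ∣ (a ^ n).y := by
    rw [← dvd_abs, ← hy, dvd_abs]; exact hdl
  have hpz : Prime (d : ℤ) := Nat.prime_iff_prime_int.1 hp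
  have h6 : (d : ℤ) ∣ n * (a.x ^ n * a.y) := by
    have h7 := (y_pow_modEq a n).1.dvd
    exact (dvd_sub_left (hdy.mul_left _)).1 h7
  rcases hpz.dvd_or_dvd h6 with h7 | h7
  · have := Nat.le_of_dvd (Nat.pos_of_ne_zero hn0) (Int.natCast_dvd_natCast.1 h7)
    omega
  · rcases hpz.dvd_or_dvd h7 with h8 | h8
    · exfalso
      have h9 : (d : ℤ) ∣ a.x := hpz.dvd_of_dvd_pow h8
      have h10 : (d : ℤ) ∣ 1 := by
        rw [← a.prop]
        exact dvd_sub (dvd_pow h9 two_ne_zero) (dvd_mul_right _ _)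
      exact hpz.not_isUnit (isUnit_of_dvd_one h10)
    · exact h8

theorem mordell_conjecture_false :
    ∃ d : ℕ, d.Prime ∧ d % 4 = 3 ∧
      ∀ a : Pell.Solution₁ (d : ℤ), Pell.IsFundamental a → (d : ℤ) ∣ a.y := by
  refine ⟨39028039587479, prime_d, by norm_num, fun a ha => ?_⟩
  refine dvd_of_rep prime_d (N := 39028156671597762437) (u := 29698894088606782278)
    (v := 4631106205489845619) (e := 13522828) ?_ ?_ ?_ ?_ ?_ a ha
  · exact_mod_cast rep18
  · norm_num
  · norm_num
  · norm_num
  · norm_num
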